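/- arXiv:1006.2671 — 2 statements merged into one kernel-verified Lean document; each statement's English description precedes it below -/
import Mathlib

section
/- For every 0 < ε ≤ 1 there exist a uniquely rooted, pruned, finitely branching subtree T of ℕ^{<ℕ} in which the number of immediate successors of a node depends only on the length of the node and is always at least 2 (a quasi-homogeneous tree), and a subset D of T such that |D ∩ T(n)| ≥ (1−ε)|T(n)| for every n ≥ 1, while no strong subtree of T is contained in D. -/
open Filter

namespace DHLPaper

/-- The tree `b^{<ℕ}` of all finite sequences with values in `{0,…,b−1}`,
partially ordered by end-extension (`List.IsPrefix`, written `<+:`). -/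
def bSeq (b : ℕ) : Set (List ℕ) := {t | ∀ x ∈ t, x < b}

/-- The set of successors of `t` in `T`: `Suc_T(t) = {s ∈ T : t ≤ s}`. -/
def suc (T : Set (List ℕ)) (t : List ℕ) : Set (List ℕ) := {s ∈ T | t <+: s}

/-- `s` is an immediate successor of `t` in `T`. -/
def ImmSuc (T : Set (List ℕ)) (t s : List ℕ) : Prop :=
  t ∈ T ∧ s ∈ T ∧ t <+: s ∧ t ≠ s ∧ ∀ u ∈ T, t <+: u → u <+: s → u = t ∨ u = s

/-- The `n`-th level of `T`: the nodes of `T` with exactly `n` strict predecessors in `T`. -/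
def level (T : Set (List ℕ)) (n : ℕ) : Set (List ℕ) :=
  {t ∈ T | {s ∈ T | s <+: t ∧ s ≠ t}.ncard = n}

/-- `T` has exactly one minimal node. -/
def UniquelyRooted (T : Set (List ℕ)) : Prop := ∃! r, r ∈ level T 0

/-- Every node of `T` has finitely many immediate successors in `T`. -/
def FinitelyBranching (T : Set (List ℕ)) : Prop := ∀ t ∈ T, {s | ImmSuc T t s}.Finite

/-- Every node of `T` has at least one immediate successor in `T`. -/
def Pruned (T : Set (List ℕ)) : Prop := ∀ t ∈ T, ∃ s, ImmSuc T t s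

/-- `S` is a strong subtree of `T` whose level set `L_T(S)` is enumerated by the strictly
increasing map `l`: `S(n) ⊆ T(l n)` for every `n`, `S` is uniquely rooted, and for every
`s ∈ S` and every immediate successor `t` of `s` in `T` there is a unique immediate
successor `s'` of `s` in `S` with `t ≤ s'`. -/
def IsStrongSubtreeWith (T S : Set (List ℕ)) (l : ℕ → ℕ) : Prop :=
  S ⊆ T ∧ UniquelyRooted S ∧ StrictMono l ∧
    (∀ n, level S n ⊆ level T (l n)) ∧
    (∀ s ∈ S, ∀ t, ImmSuc T s t → ∃! s', ImmSuc S s s' ∧ t <+: s')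

/-- `S` is a strong subtree of `T`. -/
def IsStrongSubtree (T S : Set (List ℕ)) : Prop := ∃ l, IsStrongSubtreeWith T S l

/-- A homogeneous tree with branching number `b`: a strong subtree of `b^{<ℕ}`, `b ≥ 2`. -/
def IsHomogeneous (b : ℕ) (T : Set (List ℕ)) : Prop := 2 ≤ b ∧ IsStrongSubtree (bSeq b) T

/-- A vector homogeneous tree: a `d`-tuple of homogeneous trees. -/
def IsVecHomogeneous {d : ℕ} (b : Fin d → ℕ) (T : Fin d → Set (List ℕ)) : Prop :=
  ∀ i, IsHomogeneous (b i) (T i)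

/-- Vector strong subtree: componentwise strong subtrees with a common level set. -/
def IsVecStrongSubtree {d : ℕ} (T S : Fin d → Set (List ℕ)) : Prop :=
  ∃ l, ∀ i, IsStrongSubtreeWith (T i) (S i) l

/-- `⊗T(n) = T_1(n) × ⋯ × T_d(n)`. -/
def vecLevel {d : ℕ} (T : Fin d → Set (List ℕ)) (n : ℕ) : Set (Fin d → List ℕ) :=
  {v | ∀ i, v i ∈ level (T i) n}

/-- The level product `⊗T = ⋃_n ⊗T(n)`. -/
def levelProd {d : ℕ} (T : Fin d → Set (List ℕ)) : Set (Fin d → List ℕ) :=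
  ⋃ n, vecLevel T n

/-- `r` is the root tuple of the vector tree `T`. -/
def IsRoot {d : ℕ} (T : Fin d → Set (List ℕ)) (r : Fin d → List ℕ) : Prop :=
  ∀ i, level (T i) 0 = {r i}

/-- `F` is a vector fan of `T`: `F = (R_1(0) ∪ R_1(1), …, R_d(0) ∪ R_d(1))` for some
vector strong subtree `R` of `T`. -/
def IsVecFan {d : ℕ} (T F : Fin d → Set (List ℕ)) : Prop :=
  ∃ R : Fin d → Set (List ℕ), IsVecStrongSubtree T R ∧
    ∀ i, F i = level (R i) 0 ∪ level (R i) 1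

/-- `fan(T,n)`: the vector fans of `T` with `⊗F(1) ⊆ ⊗T(n)`. -/
def fanAt {d : ℕ} (T : Fin d → Set (List ℕ)) (n : ℕ) : Set (Fin d → Set (List ℕ)) :=
  {F | IsVecFan T F ∧ vecLevel F 1 ⊆ vecLevel T n}

/-- Density of `F ⊆ W(n)` in the `n`-th level of `W`. -/
noncomputable def dens (W : Set (List ℕ)) (n : ℕ) (F : Set (List ℕ)) : ℝ :=
  (F.ncard : ℝ) / ((level W n).ncard : ℝ)

/-- Density of `F ⊆ W(n)` relative to the node `w`. -/
noncomputable def densRel (W : Set (List ℕ)) (n : ℕ) (F : Set (List ℕ)) (w : List ℕ) : ℝ :=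
  ((F ∩ suc W w).ncard : ℝ) / ((level W n ∩ suc W w).ncard : ℝ)

/-- `s = w ⌢_W p`: `s` is the immediate successor of `w` in `W` such that the
concatenation `w ⌢ p` is an initial segment of `s`. -/
def IsConcat (W : Set (List ℕ)) (w : List ℕ) (p : ℕ) (s : List ℕ) : Prop :=
  ImmSuc W w s ∧ w ++ [p] <+: s

/-- The density Halpern–Läuchli statement in dimension `d`. -/
def DHL (d : ℕ) : Prop :=
  ∀ (b : Fin d → ℕ) (T : Fin d → Set (List ℕ)), IsVecHomogeneous b T →
    ∀ D : Set (Fin d → List ℕ), D ⊆ levelProd T →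
      0 < Filter.limsup
          (fun n => ((D ∩ vecLevel T n).ncard : ℝ) / ((vecLevel T n).ncard : ℝ)) atTop →
      ∃ S : Fin d → Set (List ℕ), IsVecStrongSubtree T S ∧ levelProd S ⊆ D

/-- `D : ⊗T → 2^W` is an `ε`-dense level selection along the strictly increasing
sequence `l`: for every `n` and every `t⃗ ∈ ⊗T(n)`, `D(t⃗) ⊆ W(l n)` and
`dens(D(t⃗)) ≥ ε`. -/
def IsDenseLevelSel {d : ℕ} (T : Fin d → Set (List ℕ)) (W : Set (List ℕ)) (l : ℕ → ℕ)
    (ε : ℝ) (D : (Fin d → List ℕ) → Set (List ℕ)) : Prop :=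
  StrictMono l ∧ ∀ n, ∀ v ∈ vecLevel T n, D v ⊆ level W (l n) ∧ ε ≤ dens W (l n) (D v)

/-- The pair `(R, w)` (`R` a vector strong subtree of `T` with root tuple `r0`) is strongly
`θ`-correlated with respect to the dense level selection `D` (with level sequence `l`):
`w ∈ D(r0)` and for every vector fan `F` of `R` with `F(0) = r0` and every `p < b_W`,
`dens(⋂_{r ∈ ⊗F(1)} D(r) | w ⌢_W p) ≥ θ`. -/
def StronglyCorrelated {d : ℕ} (T : Fin d → Set (List ℕ)) (W : Set (List ℕ)) (bW : ℕ)
    (l : ℕ → ℕ) (D : (Fin d → List ℕ) → Set (List ℕ)) (R : Fin d → Set (List ℕ))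
    (r0 : Fin d → List ℕ) (w : List ℕ) (θ : ℝ) : Prop :=
  w ∈ D r0 ∧
    ∀ F : Fin d → Set (List ℕ), IsVecFan R F → IsRoot F r0 →
      ∀ n, vecLevel F 1 ⊆ vecLevel T n →
        ∀ p < bW, ∀ s, IsConcat W w p s →
          θ ≤ densRel W (l n) (⋂ r ∈ vecLevel F 1, D r) s

/-- The finite sequences whose `i`-th entry lies in the interval `[a, f i)`. -/
def box (a : ℕ) (f : ℕ → ℕ) : Set (List ℕ) :=
  {t | ∀ i, ∀ h : i < t.length, a ≤ t[i] ∧ t[i] < f i}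

lemma mem_box_of_prefix {a : ℕ} {f : ℕ → ℕ} {s t : List ℕ} (ht : t ∈ box a f)
    (hst : s <+: t) : s ∈ box a f := by
  intro i hi
  rw [hst.getElem hi]
  exact ht i (hi.trans_le hst.length_le)

lemma append_singleton_mem_box {a : ℕ} {f : ℕ → ℕ} {t : List ℕ} {k : ℕ} :
    t ++ [k] ∈ box a f ↔ t ∈ box a f ∧ a ≤ k ∧ k < f t.length := by
  constructor
  · intro h
    refine ⟨mem_box_of_prefix h (List.prefix_append _ _), ?_⟩
    simpa using h t.length (by simp)
  · rintro ⟨ht, hk⟩ i hi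
    rcases Nat.lt_or_ge i t.length with h | h
    · simpa [List.getElem_append_left h] using ht i h
    · obtain rfl : i = t.length := by simp at hi; omega
      simpa using hk

lemma level_box (a : ℕ) (f : ℕ → ℕ) (n : ℕ) :
    level (box a f) n = {t ∈ box a f | t.length = n} := by
  ext t
  refine and_congr_right fun ht => ?_
  have : {s ∈ box a f | s <+: t ∧ s ≠ t} = (fun i => t.take i) '' Set.Iio t.length := by
    ext s
    constructor
    · rintro ⟨-, hst, hne⟩
      refine ⟨s.length, ?_, (List.prefix_iff_eq_take.1 hst).symm⟩
      exact lt_of_le_of_ne hst.length_le fun h => hne (hst.eq_of_length h)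
    · rintro ⟨i, hi, rfl⟩
      refine ⟨mem_box_of_prefix ht (List.take_prefix _ _), List.take_prefix _ _, fun h => ?_⟩
      have := congrArg List.length h
      simp at this hi
      omega
  rw [this, Set.InjOn.ncard_image]
  · simp [Set.ncard_eq_toFinset_card']
  · intro i hi j hj h
    have := congrArg List.length h
    simp at this hi hj
    omega

lemma immSuc_box {a : ℕ} {f : ℕ → ℕ} {t s : List ℕ} (ht : t ∈ box a f) :
    ImmSuc (box a f) t s ↔ ∃ k ∈ Set.Ico a (f t.length), t ++ [k] = s := by
  constructor
  · rintro ⟨-, hs, ⟨r, rfl⟩, hne, himm⟩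
    cases r with
    | nil => simp at hne
    | cons k r =>
      have hpre : t ++ [k] <+: t ++ k :: r := ⟨r, by simp⟩
      have hmem := mem_box_of_prefix hs hpre
      refine ⟨k, (append_singleton_mem_box.1 hmem).2, ?_⟩
      exact (himm _ hmem (List.prefix_append _ _) hpre).resolve_left (by simp)
  · rintro ⟨k, hk, rfl⟩
    refine ⟨ht, append_singleton_mem_box.2 ⟨ht, hk⟩, List.prefix_append _ _, by simp, ?_⟩
    intro u _ htu hu
    rcases List.prefix_concat_iff.1 hu with h | h
    · exact Or.inr h
    · exact Or.inl (h.eq_of_length (le_antisymm h.length_le htu.length_le))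

lemma setOf_immSuc_box {a : ℕ} {f : ℕ → ℕ} {t : List ℕ} (ht : t ∈ box a f) :
    {s | ImmSuc (box a f) t s} = (fun k => t ++ [k]) '' Set.Ico a (f t.length) :=
  Set.ext fun _ => immSuc_box ht

lemma ncard_box_length (a : ℕ) (f : ℕ → ℕ) (n : ℕ) :
    {t ∈ box a f | t.length = n}.ncard = ∏ i ∈ Finset.range n, (f i - a) := by
  have : {t ∈ box a f | t.length = n} =
      (List.ofFn : (Fin n → ℕ) → List ℕ) ''
        (Fintype.piFinset fun i : Fin n => Finset.Ico a (f i) : Finset (Fin n → ℕ)) := by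
    ext t
    constructor
    · rintro ⟨ht, rfl⟩
      exact ⟨t.get, by simpa using fun i : Fin t.length => ht i i.2, List.ofFn_get t⟩
    · rintro ⟨v, hv, rfl⟩
      simp only [Finset.mem_coe, Fintype.mem_piFinset, Finset.mem_Ico] at hv
      refine ⟨fun i hi => ?_, by simp⟩
      simpa using hv ⟨i, by simpa using hi⟩
  rw [this, Set.ncard_image_of_injective _ List.ofFn_injective, Set.ncard_coe_finset,
    Fintype.card_piFinset, Finset.prod_range]
  simp

lemma one_sub_mul_prod_le {ε : ℝ} {K : ℕ} (hε : 0 < ε) (hK : 1 ≤ ε * K) (n : ℕ) :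
    (1 - ε * (1 - (1 / 2) ^ n)) * ∏ i ∈ Finset.range n, (2 ^ (i + 1) * K : ℝ) ≤
      ∏ i ∈ Finset.range n, (2 ^ (i + 1) * K - 1 : ℝ) := by
  have hK1 : (1 : ℝ) ≤ K := by
    rcases Nat.eq_zero_or_pos K with rfl | h
    · norm_num at hK
    · exact_mod_cast h
  induction n with
  | zero => simp
  | succ n ih =>
    rw [Finset.prod_range_succ, Finset.prod_range_succ]
    have hpow : (1 : ℝ) ≤ 2 ^ (n + 1) := one_le_pow₀ (by norm_num)
    have hpos : (0 : ℝ) ≤ ∏ i ∈ Finset.range n, (2 ^ (i + 1) * K : ℝ) :=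
      Finset.prod_nonneg fun i _ => by positivity
    have hfac : (0 : ℝ) ≤ 2 ^ (n + 1) * K - 1 := by nlinarith
    have hinv : ((1 : ℝ) / 2) ^ (n + 1) * 2 ^ (n + 1) = 1 := by
      rw [← mul_pow]; norm_num
    have hhalf : ((1 : ℝ) / 2) ^ n = 2 * (1 / 2) ^ (n + 1) := by ring
    have hle : ((1 : ℝ) / 2) ^ n ≤ 1 := pow_le_one₀ (by norm_num) (by norm_num)
    have hstep : (1 - ε * (1 - (1 / 2) ^ (n + 1))) * (2 ^ (n + 1) * K) ≤
        (1 - ε * (1 - (1 / 2) ^ n)) * (2 ^ (n + 1) * K - 1) := by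
      have hgap : (1 - ε * (1 - (1 / 2) ^ n)) * (2 ^ (n + 1) * K - 1) -
          (1 - ε * (1 - (1 / 2) ^ (n + 1))) * (2 ^ (n + 1) * K) =
          ε * K * ((1 / 2) ^ (n + 1) * 2 ^ (n + 1)) - 1 + ε * (1 - (1 / 2) ^ n) := by
        rw [hhalf]; ring
      rw [hinv] at hgap
      nlinarith [mul_nonneg hε.le (sub_nonneg.2 hle)]
    calc _ = (∏ i ∈ Finset.range n, (2 ^ (i + 1) * K : ℝ)) *
          ((1 - ε * (1 - (1 / 2) ^ (n + 1))) * (2 ^ (n + 1) * K)) := by ring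
      _ ≤ _ := mul_le_mul_of_nonneg_left hstep hpos
      _ = ((1 - ε * (1 - (1 / 2) ^ n)) * ∏ i ∈ Finset.range n, (2 ^ (i + 1) * K : ℝ)) *
          (2 ^ (n + 1) * K - 1) := by ring
      _ ≤ _ := mul_le_mul_of_nonneg_right ih hfac

lemma box_mono {a b : ℕ} (f : ℕ → ℕ) (hab : a ≤ b) : box b f ⊆ box a f :=
  fun _ ht i hi => ⟨hab.trans (ht i hi).1, (ht i hi).2⟩

/-- A strong subtree of `box 0 f` has a node above `r ++ [0]`, where `r` is its root. -/
lemma not_subset_box_one {f : ℕ → ℕ} (hf : ∀ n, 0 < f n) {S : Set (List ℕ)}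
    (hS : IsStrongSubtree (box 0 f) S) : ¬ S ⊆ box 1 f := by
  obtain ⟨l, hST, ⟨r, hr, -⟩, -, -, hsuc⟩ := hS
  intro hSD
  obtain ⟨s, ⟨⟨-, hs, -⟩, hpre⟩, -⟩ :=
    hsuc r hr.1 (r ++ [0]) ((immSuc_box (hST hr.1)).2 ⟨0, ⟨le_rfl, hf _⟩, rfl⟩)
  have := (append_singleton_mem_box.1 (mem_box_of_prefix (hSD hs) hpre)).2.1
  omega

/-- Example B.1: a quasi-homogeneous tree with a very dense subset
containing no strong subtree. -/
theorem quasi_homogeneous_counterexample (ε : ℝ) (hε0 : 0 < ε) (hε1 : ε ≤ 1) :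
    ∃ T D : Set (List ℕ),
      UniquelyRooted T ∧ Pruned T ∧ FinitelyBranching T ∧
      (∃ f : ℕ → ℕ, (∀ n, 2 ≤ f n) ∧
        ∀ n, ∀ t ∈ level T n, {s | ImmSuc T t s}.ncard = f n) ∧
      D ⊆ T ∧
      (∀ n, 1 ≤ n →
        (1 - ε) * ((level T n).ncard : ℝ) ≤ ((D ∩ level T n).ncard : ℝ)) ∧
      ∀ S : Set (List ℕ), IsStrongSubtree T S → ¬ S ⊆ D := by
  obtain ⟨K, hK⟩ := exists_nat_ge (1 / ε)
  have hKε : 1 ≤ ε * K := by rwa [div_le_iff₀' hε0] at hK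
  have hK1 : 1 ≤ K := by
    rcases Nat.eq_zero_or_pos K with rfl | h
    · norm_num at hKε
    · exact h
  set f : ℕ → ℕ := fun i => 2 ^ (i + 1) * K with hf
  have hf2 : ∀ n, 2 ≤ f n := fun n => by
    have : 1 ≤ 2 ^ n := Nat.one_le_two_pow
    simp only [hf, pow_succ]
    nlinarith
  refine ⟨box 0 f, box 1 f, ?_, ?_, ?_, ⟨f, hf2, ?_⟩, box_mono f zero_le_one, ?_, ?_⟩
  · refine ⟨[], ?_, fun t ht => ?_⟩
    · rw [level_box]
      simp [box]
    · rw [level_box] at ht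
      exact List.length_eq_zero_iff.1 ht.2
  · intro t ht
    exact ⟨_, (immSuc_box ht).2 ⟨0, ⟨le_rfl, by have := hf2 t.length; omega⟩, rfl⟩⟩
  · intro t ht
    rw [setOf_immSuc_box ht]
    exact (Set.finite_Ico _ _).image _
  · intro n t ht
    rw [level_box] at ht
    rw [setOf_immSuc_box ht.1, Set.ncard_image_of_injective _ fun i j h => by simpa using h,
      ht.2]
    simp [Set.ncard_eq_toFinset_card']
  · intro n _
    have hD : box 1 f ∩ level (box 0 f) n = {t ∈ box 1 f | t.length = n} := by
      rw [level_box]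
      ext t
      exact ⟨fun h => ⟨h.1, h.2.2⟩, fun h => ⟨h.1, box_mono f zero_le_one h.1, h.2⟩⟩
    have hcast : ∀ i, ((f i - 1 : ℕ) : ℝ) = 2 ^ (i + 1) * K - 1 := fun i => by
      rw [Nat.cast_sub (one_le_two.trans (hf2 i))]
      simp [hf]
    rw [hD, level_box, ncard_box_length, ncard_box_length, Nat.cast_prod, Nat.cast_prod,
      Finset.prod_congr rfl fun i _ => hcast i]
    refine le_trans ?_ (one_sub_mul_prod_le hε0 hKε n)
    simp only [hf, Nat.sub_zero, Nat.cast_mul, Nat.cast_pow, Nat.cast_ofNat]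
    refine mul_le_mul_of_nonneg_right ?_ (Finset.prod_nonneg fun i _ => by positivity)
    have : (0 : ℝ) ≤ ε * (1 / 2) ^ n := by positivity
    linarith
  · exact fun S hS => not_subset_box_one (fun n => two_pos.trans_le (hf2 n)) hS

end DHLPaper
end

section
/- There exist a uniquely rooted, pruned, perfect subtree T of 2^{<ℕ} (perfect: every node of T has at least two incomparable successors in T) and a subset D of T such that limsup_{n→∞} |D ∩ T(n)| / |T(n)| = 1, while no strong subtree of T is contained in D. -/
open Filter

namespace DHLPaper

/-- A `0`-`1` sequence belongs to `sparseTree` when each of its entries at a position strictly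
between `3 ^ k` and `3 ^ (k + 1)` vanishes, unless all entries up to `3 ^ k` vanish. -/
def sparseTree : Set (List ℕ) :=
  {x | x ∈ bSeq 2 ∧ ∀ k i, 3 ^ k < i → i < 3 ^ (k + 1) → x.getD i 0 ≠ 0 →
    ∀ j ≤ 3 ^ k, x.getD j 0 = 0}

/-- The nodes of `sparseTree` of length `3 ^ (k + 1)`, for some `k`, whose entries up to `3 ^ k`
all vanish. -/
def zeroCones : Set (List ℕ) :=
  {x | x ∈ sparseTree ∧ ∃ k, x.length = 3 ^ (k + 1) ∧ ∀ j ≤ 3 ^ k, x.getD j 0 = 0}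

lemma getD_eq_of_prefix {x y : List ℕ} (h : x <+: y) {i : ℕ} (hi : i < x.length) :
    x.getD i 0 = y.getD i 0 := by
  obtain ⟨z, rfl⟩ := h
  rw [List.getD_append _ _ _ _ hi]

lemma lt_length_of_getD_ne {x : List ℕ} {i : ℕ} (h : x.getD i 0 ≠ 0) : i < x.length := by
  by_contra hi
  exact h (List.getD_eq_default _ _ (not_lt.mp hi))

lemma sparseTree_of_prefix {x y : List ℕ} (h : x <+: y) (hy : y ∈ sparseTree) :
    x ∈ sparseTree := by
  refine ⟨fun a ha => hy.1 a (h.subset ha), fun k i hk hi hx j hj => ?_⟩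
  have hl := lt_length_of_getD_ne hx
  rw [getD_eq_of_prefix h (by omega)]
  rw [getD_eq_of_prefix h hl] at hx
  exact hy.2 k i hk hi hx j hj

lemma getD_append_replicate_zero (x : List ℕ) (n i : ℕ) :
    (x ++ List.replicate n 0).getD i 0 = x.getD i 0 := by
  rcases lt_or_ge i x.length with h | h
  · rw [List.getD_append _ _ _ _ h]
  · rw [List.getD_append_right _ _ _ _ h, List.getD_eq_default _ _ h]
    simp [List.getD_eq_getElem?_getD, List.getElem?_replicate]
    split_ifs <;> rfl

lemma append_replicate_zero_mem {x : List ℕ} (hx : x ∈ sparseTree) (n : ℕ) :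
    x ++ List.replicate n 0 ∈ sparseTree := by
  refine ⟨fun a ha => ?_, ?_⟩
  · rcases List.mem_append.mp ha with h | h
    · exact hx.1 a h
    · rw [List.eq_of_mem_replicate h]; norm_num
  · simpa only [getD_append_replicate_zero] using hx.2

lemma append_one_mem {x : List ℕ} (hx : x ∈ sparseTree) {k : ℕ} (hk : x.length = 3 ^ k) :
    x ++ [1] ∈ sparseTree := by
  refine ⟨fun a ha => ?_, fun m i hm hi hne j hj => ?_⟩
  · rcases List.mem_append.mp ha with h | h
    · exact hx.1 a h
    · rw [List.mem_singleton.mp h]; norm_num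
  · have hl := lt_length_of_getD_ne hne
    have hik : i < x.length := by
      rcases eq_or_ne i x.length with rfl | h
      · rw [hk] at hm hi
        have h₁ := (Nat.pow_lt_pow_iff_right (by norm_num)).mp hm
        have h₂ := (Nat.pow_lt_pow_iff_right (by norm_num)).mp hi
        omega
      · simp at hl; omega
    rw [List.getD_append _ _ _ _ hik] at hne
    rw [List.getD_append _ _ _ _ (by omega)]
    exact hx.2 m i hm hi hne j hj

lemma immSuc_append_singleton {T : Set (List ℕ)} {x : List ℕ} {a : ℕ} (hx : x ∈ T)
    (hxa : x ++ [a] ∈ T) : ImmSuc T x (x ++ [a]) := by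
  refine ⟨hx, hxa, List.prefix_append _ _, by simp, fun u _ hxu hu => ?_⟩
  rcases List.prefix_concat_iff.mp hu with h | h
  · exact Or.inr h
  · exact Or.inl (h.eq_of_length_le hxu.length_le)

/-- In a tree closed under initial segments, the level of a node is its length. -/
lemma level_eq_of_prefix_closed {T : Set (List ℕ)}
    (hT : ∀ x y : List ℕ, x <+: y → y ∈ T → x ∈ T) (n : ℕ) :
    level T n = {x ∈ T | x.length = n} := by
  ext t
  refine and_congr_right fun ht => ?_
  have h : {s ∈ T | s <+: t ∧ s ≠ t} = (fun i => t.take i) '' Set.Iio t.length := by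
    ext s
    constructor
    · rintro ⟨-, hst, hne⟩
      refine ⟨s.length, ?_, (List.prefix_iff_eq_take.mp hst).symm⟩
      exact lt_of_le_of_ne hst.length_le fun h => hne (hst.eq_of_length h)
    · rintro ⟨i, hi, rfl⟩
      refine ⟨hT _ _ (List.take_prefix _ _) ht, List.take_prefix _ _, fun h => ?_⟩
      have := congrArg List.length h
      simp only [List.length_take, Set.mem_Iio] at this hi
      omega
  have hinj : Set.InjOn (fun i => t.take i) (Set.Iio t.length) := by
    intro i hi j hj hij
    have := congrArg List.length hij
    simp only [List.length_take, Set.mem_Iio] at this hi hj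
    omega
  rw [h, hinj.ncard_image]
  simp [Set.ncard_eq_toFinset_card']

lemma level_sparseTree (n : ℕ) : level sparseTree n = {x ∈ sparseTree | x.length = n} :=
  level_eq_of_prefix_closed (fun _ _ => sparseTree_of_prefix) n

lemma bSeq_two_length_eq_range (n : ℕ) :
    {x ∈ bSeq 2 | x.length = n} =
      Set.range fun f : Fin n → Fin 2 => List.ofFn fun i => (f i : ℕ) := by
  ext x
  constructor
  · rintro ⟨hx, rfl⟩
    exact ⟨fun i => ⟨x[i], hx _ (List.getElem_mem _)⟩, by simp⟩
  · rintro ⟨f, rfl⟩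
    refine ⟨fun a ha => ?_, by simp⟩
    obtain ⟨i, rfl⟩ := (List.mem_ofFn' _ _).mp ha
    exact (f i).2

lemma finite_bSeq_two_length_eq (n : ℕ) : {x ∈ bSeq 2 | x.length = n}.Finite := by
  rw [bSeq_two_length_eq_range]
  exact Set.finite_range _

lemma ncard_bSeq_two_length_eq (n : ℕ) : {x ∈ bSeq 2 | x.length = n}.ncard = 2 ^ n := by
  rw [bSeq_two_length_eq_range, Set.ncard_range_of_injective, Nat.card_eq_fintype_card]
  · simp
  · intro f g h
    ext i
    exact congrFun (List.ofFn_injective h) i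

lemma finite_level_sparseTree (n : ℕ) : (level sparseTree n).Finite := by
  rw [level_sparseTree]
  exact (finite_bSeq_two_length_eq n).subset fun x hx => ⟨hx.1.1, hx.2⟩

lemma replicate_zero_append_mem {k : ℕ} {y : List ℕ} (hy : y ∈ bSeq 2)
    (hl : 3 ^ k + 1 + y.length = 3 ^ (k + 1)) :
    List.replicate (3 ^ k + 1) 0 ++ y ∈ zeroCones := by
  have hz : ∀ j ≤ 3 ^ k, (List.replicate (3 ^ k + 1) 0 ++ y).getD j 0 = 0 := by
    intro j hj
    rw [List.getD_append _ _ _ _ (by simp; omega)]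
    simp [List.getD_eq_getElem?_getD, List.getElem?_replicate]
    split_ifs <;> rfl
  have hlen : (List.replicate (3 ^ k + 1) 0 ++ y).length = 3 ^ (k + 1) := by simpa using hl
  refine ⟨⟨fun a ha => ?_, fun m i hm hi hne j hj => hz j (hj.trans ?_)⟩, k, hlen, hz⟩
  · rcases List.mem_append.mp ha with h | h
    · rw [List.eq_of_mem_replicate h]; norm_num
    · exact hy a h
  · have := lt_length_of_getD_ne hne
    rw [hlen] at this
    have hmk := (Nat.pow_lt_pow_iff_right (a := 3) (by norm_num)).mp (hm.trans this)
    exact Nat.pow_le_pow_right (by norm_num) (by omega)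

lemma two_pow_le_ncard_zeroCones (k : ℕ) :
    2 ^ (2 * 3 ^ k - 1) ≤ (zeroCones ∩ level sparseTree (3 ^ (k + 1))).ncard := by
  have hpos : 0 < 3 ^ k := by positivity
  have hs : 3 ^ (k + 1) = 3 * 3 ^ k := by ring
  rw [← ncard_bSeq_two_length_eq]
  refine Set.ncard_le_ncard_of_injOn (fun y => List.replicate (3 ^ k + 1) 0 ++ y) ?_ ?_
    ((finite_level_sparseTree _).subset Set.inter_subset_right)
  · rintro y ⟨hy, hl⟩
    have h := replicate_zero_append_mem (k := k) hy (by omega)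
    refine ⟨h, ?_⟩
    rw [level_sparseTree]
    refine ⟨h.1, ?_⟩
    simp only [List.length_append, List.length_replicate]
    omega
  · intro y _ z _ h
    exact List.append_cancel_left h

lemma ncard_level_diff_zeroCones_le (k : ℕ) :
    (level sparseTree (3 ^ (k + 1)) \ zeroCones).ncard ≤ 2 ^ (3 ^ k + 1) := by
  have hpos : 0 < 3 ^ k := by positivity
  have hs : 3 ^ (k + 1) = 3 * 3 ^ k := by ring
  have hzero : ∀ x ∈ level sparseTree (3 ^ (k + 1)) \ zeroCones, ∀ i, 3 ^ k < i →
      x.getD i 0 = 0 := by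
    rintro x ⟨hx, hxD⟩ i hi
    rw [level_sparseTree] at hx
    by_contra hne
    have hl := lt_length_of_getD_ne hne
    rw [hx.2] at hl
    exact hxD ⟨hx.1, k, hx.2, hx.1.2 k i hi hl hne⟩
  rw [← ncard_bSeq_two_length_eq]
  refine Set.ncard_le_ncard_of_injOn (fun x => x.take (3 ^ k + 1)) ?_ ?_
    (finite_bSeq_two_length_eq _)
  · rintro x ⟨hx, -⟩
    rw [level_sparseTree] at hx
    refine ⟨fun a ha => hx.1.1 a (List.mem_of_mem_take ha), ?_⟩
    rw [List.length_take, hx.2]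
    omega
  · intro x hx y hy hxy
    have hlx := hx.1
    have hly := hy.1
    rw [level_sparseTree] at hlx hly
    refine List.ext_getElem (hlx.2.trans hly.2.symm) fun i h₁ h₂ => ?_
    rw [← List.getD_eq_getElem x 0 h₁, ← List.getD_eq_getElem y 0 h₂]
    rcases lt_or_ge (3 ^ k) i with hi | hi
    · rw [hzero x hx i hi, hzero y hy i hi]
    · have hx' := getD_eq_of_prefix (List.take_prefix (3 ^ k + 1) x) (i := i)
        (by rw [List.length_take]; omega)
      have hy' := getD_eq_of_prefix (List.take_prefix (3 ^ k + 1) y) (i := i)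
        (by rw [List.length_take]; omega)
      rw [← hx', ← hy']
      exact congrArg (fun z => List.getD z i 0) hxy

lemma one_sub_le_density (k : ℕ) :
    1 - 4 / ((k : ℝ) + 1) ≤
      ((zeroCones ∩ level sparseTree (3 ^ (k + 1))).ncard : ℝ) /
        ((level sparseTree (3 ^ (k + 1))).ncard : ℝ) := by
  have hsum := Set.ncard_inter_add_ncard_sdiff_eq_ncard (level sparseTree (3 ^ (k + 1))) zeroCones
    (finite_level_sparseTree _)
  rw [Set.inter_comm] at hsum
  have ha := two_pow_le_ncard_zeroCones k
  have hb := ncard_level_diff_zeroCones_le k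
  rw [← hsum]
  generalize (zeroCones ∩ level sparseTree (3 ^ (k + 1))).ncard = a at *
  generalize (level sparseTree (3 ^ (k + 1)) \ zeroCones).ncard = b at *
  have hpos : 0 < 3 ^ k := by positivity
  have hapos : 0 < a := lt_of_lt_of_le (by positivity) ha
  have hk : k + 1 ≤ 2 ^ 3 ^ k :=
    (Nat.lt_pow_self (by norm_num : 1 < 3)).trans (Nat.lt_two_pow_self)
  have hab : b * (k + 1) ≤ 4 * a := calc
    b * (k + 1) ≤ 2 ^ (3 ^ k + 1) * 2 ^ 3 ^ k := Nat.mul_le_mul hb hk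
    _ = 4 * 2 ^ (2 * 3 ^ k - 1) := by
      rw [← pow_add, show 3 ^ k + 1 + 3 ^ k = 2 + (2 * 3 ^ k - 1) by omega, pow_add]
      norm_num
    _ ≤ 4 * a := Nat.mul_le_mul_left _ ha
  have hab' : (b : ℝ) * (k + 1) ≤ 4 * a := by exact_mod_cast hab
  have hapos' : (0 : ℝ) < a := by exact_mod_cast hapos
  have hb0 : (0 : ℝ) ≤ b := Nat.cast_nonneg b
  have hk0 : (0 : ℝ) < (k : ℝ) + 1 := by positivity
  push_cast
  rw [le_div_iff₀ (by positivity), sub_mul, div_mul_eq_mul_div, sub_le_comm, le_div_iff₀ hk0]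
  nlinarith

lemma limsup_density_eq_one :
    limsup (fun n => ((zeroCones ∩ level sparseTree n).ncard : ℝ) /
      ((level sparseTree n).ncard : ℝ)) atTop = 1 := by
  have hle : ∀ n, ((zeroCones ∩ level sparseTree n).ncard : ℝ) /
      ((level sparseTree n).ncard : ℝ) ≤ 1 := by
    intro n
    refine div_le_one_of_le₀ (Nat.cast_le.mpr ?_) (Nat.cast_nonneg _)
    exact Set.ncard_le_ncard Set.inter_subset_right (finite_level_sparseTree n)
  have hbdd : IsBoundedUnder (· ≤ ·) atTop fun n =>
      ((zeroCones ∩ level sparseTree n).ncard : ℝ) / ((level sparseTree n).ncard : ℝ) :=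
    isBoundedUnder_of ⟨1, hle⟩
  have hcobdd : IsCoboundedUnder (· ≤ ·) atTop fun n =>
      ((zeroCones ∩ level sparseTree n).ncard : ℝ) / ((level sparseTree n).ncard : ℝ) :=
    (isBoundedUnder_of ⟨0, fun n => by positivity⟩ :
      IsBoundedUnder (· ≥ ·) atTop _).isCoboundedUnder_le
  refine le_antisymm (limsup_le_of_le hcobdd (Eventually.of_forall hle)) ?_
  refine le_of_forall_lt_imp_le_of_dense fun c hc => le_limsup_of_frequently_le ?_ hbdd
  have hlim : Tendsto (fun k : ℕ => 1 - 4 / ((k : ℝ) + 1)) atTop (nhds 1) := by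
    have h := (tendsto_one_div_add_atTop_nhds_zero_nat (𝕜 := ℝ)).const_mul 4
    simpa [div_eq_mul_inv] using h.const_sub 1
  have hpow : Tendsto (fun k : ℕ => 3 ^ (k + 1)) atTop atTop :=
    (tendsto_pow_atTop_atTop_of_one_lt (by norm_num : 1 < 3)).comp (tendsto_add_atTop_nat 1)
  refine hpow.frequently (Eventually.frequently ?_)
  filter_upwards [hlim.eventually_const_lt hc] with k hk
  exact hk.le.trans (one_sub_le_density k)

lemma nil_mem_sparseTree : [] ∈ sparseTree :=
  ⟨fun _ h => absurd h List.not_mem_nil, fun _ _ _ _ h => absurd rfl h⟩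

lemma not_subset_zeroCones {S : Set (List ℕ)} (hS : IsStrongSubtree sparseTree S) :
    ¬ S ⊆ zeroCones := by
  intro hSD
  obtain ⟨l, -, ⟨r, hr, -⟩, -, -, hsuc⟩ := hS
  obtain ⟨hrT, k, hk, -⟩ := hSD hr.1
  obtain ⟨s, ⟨hs, hrs⟩, -⟩ := hsuc r hr.1 (r ++ [1])
    (immSuc_append_singleton hrT (append_one_mem hrT hk))
  obtain ⟨-, m, hm, hz⟩ := hSD hs.2.1
  have hlen := hrs.length_le
  simp only [List.length_append, List.length_singleton] at hlen
  have hkm : 3 ^ (k + 1) < 3 ^ (m + 1) := by omega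
  have hkm' := (Nat.pow_lt_pow_iff_right (by norm_num)).mp hkm
  have h₀ := hz r.length (hk ▸ Nat.pow_le_pow_right (by norm_num) (by omega))
  rw [← getD_eq_of_prefix hrs (by simp), List.getD_append_right _ _ _ _ le_rfl] at h₀
  simp at h₀

/-- Example B.2: a uniquely rooted, pruned, perfect subtree of `2^{<ℕ}`
with a subset of upper density one containing no strong subtree. -/
theorem perfect_tree_counterexample :
    ∃ T D : Set (List ℕ),
      T ⊆ bSeq 2 ∧ UniquelyRooted T ∧ Pruned T ∧
      (∀ t ∈ T, ∃ s1 ∈ T, ∃ s2 ∈ T,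
        t <+: s1 ∧ t <+: s2 ∧ ¬ s1 <+: s2 ∧ ¬ s2 <+: s1) ∧
      D ⊆ T ∧
      Filter.limsup
        (fun n => ((D ∩ level T n).ncard : ℝ) / ((level T n).ncard : ℝ)) atTop = 1 ∧
      ∀ S : Set (List ℕ), IsStrongSubtree T S → ¬ S ⊆ D := by
  refine ⟨sparseTree, zeroCones, fun x hx => hx.1, ?_, fun t ht => ?_, fun t ht => ?_,
    fun x hx => hx.1, limsup_density_eq_one, fun S => not_subset_zeroCones⟩
  · rw [UniquelyRooted, level_sparseTree]
    exact ⟨[], ⟨nil_mem_sparseTree, rfl⟩, fun y hy => List.length_eq_zero_iff.mp hy.2⟩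
  · exact ⟨t ++ [0], immSuc_append_singleton ht (append_replicate_zero_mem ht 1)⟩
  · have hu := append_replicate_zero_mem ht (3 ^ t.length - t.length)
    have hul : (t ++ List.replicate (3 ^ t.length - t.length) 0).length = 3 ^ t.length := by
      have := Nat.lt_pow_self (n := t.length) (by norm_num : 1 < 3)
      simp only [List.length_append, List.length_replicate]
      omega
    have htu := List.prefix_append t (List.replicate (3 ^ t.length - t.length) 0)
    refine ⟨_, append_replicate_zero_mem hu 1, _, append_one_mem hu hul,
      htu.trans (List.prefix_append _ _), htu.trans (List.prefix_append _ _), ?_, ?_⟩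
    · simp
    · simp
end DHLPaper
end
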